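/- (Symmetric extended Routh–Hurwitz criterion) Let p(z) = b₀zⁿ + ⋯ + b_n be a real polynomial of degree n with positive leading coefficient b₀ > 0, and suppose the number zero is a root of p with multiplicity n₀, where 0 ≤ n₀ < n (multiplicity zero meaning 0 is not a root). Then every nonzero complex root of p has positive real part if and only if the Hurwitz determinants of p satisfy (−1)^{⌈k/2⌉} Δ_k > 0 for all k = 1, 2, …, n−n₀, where ⌈k/2⌉ is the least integer greater than or equal to k/2. -/

import Mathlib

/-- The `k`-th Hurwitz determinant of a real polynomial `p` of degree `n`:
the determinant of the `k × k` matrix whose `(i, j)` entry (1-based indices)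
is `b_{2j - i}`, where `b_m` is the coefficient of `z^(n - m)` in `p`
(with the convention `b_m = 0` for `m < 0` or `m > n`). -/
noncomputable def hurwitzDet (p : Polynomial ℝ) (k : ℕ) : ℝ :=
  Matrix.det (Matrix.of fun i j : Fin k =>
    if 0 ≤ 2 * (j : ℤ) - (i : ℤ) + 1 ∧ 2 * (j : ℤ) - (i : ℤ) + 1 ≤ (p.natDegree : ℤ)
    then p.coeff (p.natDegree - (2 * (j : ℤ) - (i : ℤ) + 1).toNat)
    else 0)

namespace RouthHurwitz

open Polynomial

/-- The coefficient of `X ^ k` for an integer exponent `k`, zero for negative `k`. -/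
noncomputable def intCoeff (p : ℝ[X]) (k : ℤ) : ℝ :=
  if 0 ≤ k then p.coeff k.toNat else 0

/-- The Hurwitz determinant of `p` of order `k`, with `p` viewed as having formal degree `m`. -/
noncomputable def formalHurwitzDet (p : ℝ[X]) (m k : ℕ) : ℝ :=
  Matrix.det (Matrix.of fun i j : Fin k => intCoeff p (m - (2 * (j : ℤ) - (i : ℤ) + 1)))

/-- The part of `p` consisting of the monomials whose exponent has the same parity as `m`. -/
noncomputable def parityPart (p : ℝ[X]) (m : ℕ) : ℝ[X] :=
  C (1 / 2) * (p + C ((-1) ^ m) * p.comp (-X))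

/-- One step of the Routh algorithm, lowering the formal degree from `m + 1` to `m`. -/
noncomputable def routhStep (p : ℝ[X]) (m : ℕ) (c : ℝ) : ℝ[X] :=
  p - C c * X * parityPart p m

lemma coeff_comp_neg_X (p : ℝ[X]) (k : ℕ) : (p.comp (-X)).coeff k = (-1) ^ k * p.coeff k := by
  have h : (-X : ℝ[X]) = C (-1) * X := by simp
  rw [h, comp_C_mul_X_coeff, mul_comm]

lemma coeff_parityPart (p : ℝ[X]) (m k : ℕ) :
    (parityPart p m).coeff k = if Even (m + k) then p.coeff k else 0 := by
  have h : (parityPart p m).coeff k = 1 / 2 * (p.coeff k + (-1) ^ (m + k) * p.coeff k) := by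
    rw [parityPart, coeff_C_mul, coeff_add, coeff_C_mul, coeff_comp_neg_X, pow_add, mul_assoc]
  rw [h]
  split_ifs with hk
  · rw [hk.neg_one_pow]; ring
  · rw [(Nat.not_even_iff_odd.mp hk).neg_one_pow]; ring

lemma intCoeff_routhStep (p : ℝ[X]) (m : ℕ) (c : ℝ) (k : ℤ) :
    intCoeff (routhStep p m c) k
      = intCoeff p k - if Even ((m : ℤ) + k + 1) then c * intCoeff p (k - 1) else 0 := by
  rcases lt_trichotomy k 0 with hk | rfl | hk
  · simp [intCoeff, hk.not_ge, show ¬ (1 ≤ k) by omega]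
  · simp [intCoeff, routhStep, mul_assoc]
  · obtain ⟨l, rfl⟩ : ∃ l : ℕ, k = l + 1 := ⟨(k - 1).toNat, by omega⟩
    have h1 : ((l : ℤ) + 1).toNat = l + 1 := by omega
    have h2 : Even ((m : ℤ) + (l + 1) + 1) ↔ Even (m + l) := by
      rw [Int.even_iff, Nat.even_iff]; omega
    have h3 : 0 ≤ (l : ℤ) + 1 := by omega
    simp only [intCoeff, h1, h2, h3, routhStep, coeff_sub, mul_assoc, coeff_C_mul, coeff_X_mul,
      coeff_parityPart]
    simp

lemma natDegree_parityPart_le {p : ℝ[X]} {m : ℕ} (hp : p.natDegree ≤ m + 1) :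
    (parityPart p m).natDegree ≤ m := by
  rw [natDegree_le_iff_coeff_eq_zero]
  intro k hk
  rw [coeff_parityPart]
  split_ifs with h
  · apply coeff_eq_zero_of_natDegree_lt
    rcases h with ⟨r, hr⟩
    omega
  · rfl

lemma coeff_routhStep_self (p : ℝ[X]) (m : ℕ) (c : ℝ) :
    (routhStep p m c).coeff m = p.coeff m := by
  have h := intCoeff_routhStep p m c m
  have : ¬ Even ((m : ℤ) + m + 1) := by rw [Int.even_iff]; omega
  simpa [intCoeff, this] using h

lemma natDegree_routhStep_le {p : ℝ[X]} {m : ℕ} {c : ℝ} (hp : p.natDegree ≤ m + 1)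
    (hc : p.coeff (m + 1) = c * p.coeff m) : (routhStep p m c).natDegree ≤ m := by
  rw [natDegree_le_iff_coeff_eq_zero]
  rintro (_ | k) hk
  · omega
  rw [routhStep, coeff_sub, mul_assoc, coeff_C_mul, coeff_X_mul]
  rcases eq_or_lt_of_le (show m ≤ k by omega) with rfl | hk'
  · simp [coeff_parityPart, hc]
  · rw [coeff_eq_zero_of_natDegree_lt (show p.natDegree < k + 1 by omega),
      coeff_eq_zero_of_natDegree_lt ((natDegree_parityPart_le hp).trans_lt hk')]
    simp

lemma intCoeff_eq_zero {p : ℝ[X]} {m : ℕ} (hp : p.natDegree ≤ m) {k : ℤ} (hk : (m : ℤ) < k) :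
    intCoeff p k = 0 := by
  rw [intCoeff]
  split_ifs
  · exact coeff_eq_zero_of_natDegree_lt (by omega)
  · rfl

lemma hurwitzDet_eq_formalHurwitzDet (p : ℝ[X]) (k : ℕ) :
    hurwitzDet p k = formalHurwitzDet p p.natDegree k := by
  unfold hurwitzDet formalHurwitzDet
  congr 1
  ext i j
  simp only [Matrix.of_apply]
  split_ifs with h
  · rw [intCoeff, if_pos (by omega)]
    congr 1
    omega
  · by_cases h' : 0 ≤ 2 * (j : ℤ) - (i : ℤ) + 1
    · rw [intCoeff, if_neg (by omega)]
    · rw [intCoeff_eq_zero le_rfl (by omega)]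

lemma formalHurwitzDet_succ {p : ℝ[X]} {m : ℕ} {c : ℝ} (hp : p.natDegree ≤ m + 1)
    (hc : p.coeff (m + 1) = c * p.coeff m) (k : ℕ) :
    formalHurwitzDet p (m + 1) (k + 1)
      = p.coeff m * formalHurwitzDet (routhStep p m c) m k := by
  set a : ℤ → ℝ := fun e => intCoeff p (m + 1 - e) with ha
  set a' : ℤ → ℝ := fun e => if Even e then a e - c * a (e + 1) else a e with ha'
  have ha0 : ∀ e < 0, a e = 0 := fun e he => intCoeff_eq_zero hp (by push_cast; omega)
  have ha'0 : ∀ e ≤ 0, a' e = 0 := by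
    intro e he
    rcases eq_or_lt_of_le he with rfl | he
    · have h1 : a 0 = p.coeff (m + 1) := by
        simp only [ha, intCoeff]; rw [if_pos (by omega)]; congr 1
      have h2 : a 1 = p.coeff m := by simp [ha, intCoeff]
      simp [ha', h1, h2, hc]
    · by_cases hE : Even e
      · have : e + 1 < 0 := by rcases hE with ⟨r, hr⟩; omega
        simp [ha', hE, ha0 e he, ha0 _ this]
      · simp [ha', hE, ha0 e he]
  have hstep : ∀ e : ℤ, intCoeff (routhStep p m c) (m - e) = a' (e + 1) := by
    intro e
    rw [intCoeff_routhStep]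
    have h2 : Even ((m : ℤ) + (m - e) + 1) ↔ Even (e + 1) := by
      rw [Int.even_iff, Int.even_iff]; omega
    have e1 : (m : ℤ) + 1 - (e + 1) = m - e := by ring
    have e2 : (m : ℤ) + 1 - (e + 1 + 1) = m - e - 1 := by ring
    simp only [h2, ha', ha, e1, e2]
    split_ifs <;> ring
  let B : Matrix (Fin (k + 1)) (Fin (k + 1)) ℝ := Matrix.of fun i j =>
    if Even (i : ℕ) then a (2 * (j : ℤ) - (i : ℤ) + 1) else a' (2 * (j : ℤ) - (i : ℤ) + 1)
  have hB : formalHurwitzDet p (m + 1) (k + 1) = B.det := by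
    unfold formalHurwitzDet
    refine Matrix.det_eq_of_forall_row_eq_smul_add_pred
      (fun i : Fin k => if Even (i : ℕ) then c else 0) ?_ ?_
    · intro j
      simp [B, ha]
    · intro i j
      have hs : Even ((i : ℕ) + 1) ↔ ¬ Even (i : ℕ) := Nat.even_add_one
      have ee : 2 * (j : ℤ) - ((i : ℤ) + 1) + 1 = 2 * j - i := by ring
      have e3 : (m : ℤ) + 1 - (2 * j - i + 1) = m - (2 * j - i) := by ring
      simp only [B, Matrix.of_apply, Fin.val_succ, Fin.val_castSucc, hs, Nat.cast_add,
        Nat.cast_one, ee]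
      by_cases hi : Even (i : ℕ)
      · have hE : Even (2 * (j : ℤ) - i) := by
          rw [Nat.even_iff] at hi; rw [Int.even_iff]; omega
        simp [hi, ha', hE, ha]
      · simp [hi, ha]
  have hcol : ∀ i : Fin k, B i.succ 0 = 0 := by
    intro i
    simp only [B, Matrix.of_apply, Fin.val_succ, Fin.val_zero, Nat.cast_add, Nat.cast_one]
    split_ifs with h
    · apply ha0
      rcases h with ⟨r, hr⟩
      push_cast
      omega
    · apply ha'0
      push_cast
      omega
  rw [hB, Matrix.det_succ_column_zero, Fin.sum_univ_succ]
  simp only [hcol, mul_zero, zero_mul, Finset.sum_const_zero, add_zero]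
  have hB0 : B 0 0 = p.coeff m := by simp [B, ha, intCoeff]
  rw [hB0]
  simp only [Fin.val_zero, pow_zero, one_mul]
  congr 1
  unfold formalHurwitzDet
  congr 1
  ext i j
  simp only [Matrix.submatrix_apply, Matrix.of_apply, B, Fin.val_succ, Fin.succAbove_zero]
  rw [hstep]
  have hs : Even ((i : ℕ) + 1) ↔ ¬ Even (i : ℕ) := Nat.even_add_one
  have ee : 2 * ((j : ℕ) + 1 : ℕ) - (((i : ℕ) + 1 : ℕ) : ℤ) + 1 = 2 * j - i + 1 + 1 := by
    push_cast; ring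
  rw [ee]
  by_cases hi : Even (i : ℕ)
  · simp [hs, hi]
  · have hE : ¬ Even (2 * (j : ℤ) - i + 1 + 1) := by
      rw [Nat.even_iff] at hi; rw [Int.even_iff]; omega
    simp [hs, hi, ha', hE]

lemma norm_aeval_neg_eq (p : ℝ[X]) (z : ℂ) :
    ‖aeval (-z) p‖ = ‖aeval (-(starRingEnd ℂ z)) p‖ := by
  rw [← map_neg, aeval_conj, RCLike.norm_conj]

lemma norm_aeval_neg_of_re_eq_zero (p : ℝ[X]) {z : ℂ} (hz : z.re = 0) :
    ‖aeval (-z) p‖ = ‖aeval z p‖ := by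
  rw [norm_aeval_neg_eq]
  have : -(starRingEnd ℂ z) = z := by apply Complex.ext <;> simp [hz]
  rw [this]

lemma norm_aeval_eq_prod (p : ℝ[X]) (z : ℂ) :
    ‖aeval z p‖ = |p.leadingCoeff| * ((p.aroots ℂ).map fun r => ‖z - r‖).prod := by
  rw [(IsAlgClosed.splits (p.map (algebraMap ℝ ℂ))).aeval_eq_prod_aroots, norm_mul, aroots]
  congr 1
  · simp
  · generalize (p.map (algebraMap ℝ ℂ)).roots = s
    induction s using Multiset.induction_on with
    | empty => simp
    | cons r s ih => simp [ih]

lemma prod_map_lt_prod_map {s : Multiset ℂ} {f g : ℂ → ℝ} (hs : s ≠ 0)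
    (hf : ∀ r ∈ s, 0 ≤ f r) (hfg : ∀ r ∈ s, f r < g r) : (s.map f).prod < (s.map g).prod := by
  induction s using Multiset.induction_on with
  | empty => exact absurd rfl hs
  | cons r s ih =>
    rw [Multiset.map_cons, Multiset.prod_cons, Multiset.map_cons, Multiset.prod_cons]
    have hr := hfg r (Multiset.mem_cons_self r s)
    have hr0 := hf r (Multiset.mem_cons_self r s)
    by_cases h0 : s = 0
    · simpa [h0] using hr
    · have hlt := ih h0 (fun x hx => hf x (Multiset.mem_cons_of_mem hx))
        (fun x hx => hfg x (Multiset.mem_cons_of_mem hx))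
      have hnn : 0 ≤ (s.map f).prod := by
        apply Multiset.prod_nonneg
        intro a ha
        obtain ⟨x, hx, rfl⟩ := Multiset.mem_map.mp ha
        exact hf x (Multiset.mem_cons_of_mem hx)
      exact mul_lt_mul'' hr hlt hr0 hnn

lemma norm_aeval_neg_lt {p : ℝ[X]} (hdeg : 0 < p.natDegree)
    (hp : ∀ z : ℂ, aeval z p = 0 → z.re < 0) {z : ℂ} (hz : 0 < z.re) :
    ‖aeval (-z) p‖ < ‖aeval z p‖ := by
  have hp0 : p ≠ 0 := by rintro rfl; simp at hdeg
  rw [norm_aeval_neg_eq, norm_aeval_eq_prod, norm_aeval_eq_prod]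
  refine mul_lt_mul_of_pos_left ?_ (abs_pos.mpr (leadingCoeff_ne_zero.mpr hp0))
  refine prod_map_lt_prod_map ?_ (fun _ _ => norm_nonneg _) ?_
  · rw [← Multiset.card_pos, aroots, ← (IsAlgClosed.splits _).natDegree_eq_card_roots]
    simpa using hdeg
  · intro r hr
    have hr' := hp r (mem_aroots.mp hr).2
    rw [← sq_lt_sq₀ (norm_nonneg _) (norm_nonneg _), Complex.sq_norm, Complex.sq_norm,
      Complex.normSq_apply, Complex.normSq_apply]
    simp
    nlinarith

lemma norm_aeval_neg_le {p : ℝ[X]}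
    (hp : ∀ z : ℂ, aeval z p = 0 → z.re < 0) {z : ℂ} (hz : 0 ≤ z.re) :
    ‖aeval (-z) p‖ ≤ ‖aeval z p‖ := by
  rcases Nat.eq_zero_or_pos p.natDegree with h | h
  · rw [eq_C_of_natDegree_eq_zero h]; simp
  · rcases hz.eq_or_lt with h0 | h0
    · exact (norm_aeval_neg_of_re_eq_zero p h0.symm).le
    · exact (norm_aeval_neg_lt h hp h0).le

lemma coeff_pos_of_stable {p : ℝ[X]} {m : ℕ} (hdeg : p.natDegree = m + 1)
    (hlead : 0 < p.leadingCoeff) (hp : ∀ z : ℂ, aeval z p = 0 → z.re < 0) : 0 < p.coeff m := by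
  have hp0 : p ≠ 0 := by rintro rfl; simp at hdeg
  have h := (IsAlgClosed.splits
    (p.map (algebraMap ℝ ℂ))).nextCoeff_eq_neg_sum_roots_mul_leadingCoeff
  rw [nextCoeff_map (algebraMap ℝ ℂ).injective, nextCoeff_of_natDegree_pos (by omega), hdeg,
    leadingCoeff_map] at h
  have h' := congrArg Complex.re h
  simp only [Nat.add_sub_cancel, Complex.coe_algebraMap, Complex.ofReal_re, neg_mul,
    Complex.neg_re, Complex.re_ofReal_mul] at h'
  have hcard : 0 < Multiset.card (p.map (algebraMap ℝ ℂ)).roots := by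
    rw [← (IsAlgClosed.splits _).natDegree_eq_card_roots]
    simp [hdeg]
  have hneg : ∀ s : Multiset ℂ, 0 < Multiset.card s → (∀ r ∈ s, r.re < 0) → s.sum.re < 0 := by
    intro s
    induction s using Multiset.induction_on with
    | empty => simp
    | cons r s ih =>
      intro _ hs
      have hr := hs r (Multiset.mem_cons_self r s)
      rcases Nat.eq_zero_or_pos (Multiset.card s) with h0 | h0
      · rw [Multiset.card_eq_zero.mp h0]; simpa using hr
      · have := ih h0 fun x hx => hs x (Multiset.mem_cons_of_mem hx)
        simp only [Multiset.sum_cons, Complex.add_re]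
        linarith
  have hsum := hneg _ hcard fun r hr => hp r (mem_aroots.mp hr).2
  rw [h']
  nlinarith

lemma aeval_comp_neg_X (p : ℝ[X]) (z : ℂ) : aeval z (p.comp (-X)) = aeval (-z) p := by
  rw [aeval_comp]; simp

lemma two_mul_aeval_parityPart (p : ℝ[X]) (m : ℕ) (z : ℂ) :
    2 * aeval z (parityPart p m) = aeval z p + (-1) ^ m * aeval (-z) p := by
  simp [parityPart, aeval_comp_neg_X]

lemma aeval_routhStep (p : ℝ[X]) (m : ℕ) (c : ℝ) (z : ℂ) :
    aeval z (routhStep p m c) = aeval z p - c * z * aeval z (parityPart p m) := by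
  simp [routhStep]

lemma aeval_neg_parityPart (p : ℝ[X]) (m : ℕ) (z : ℂ) :
    aeval (-z) (parityPart p m) = (-1) ^ m * aeval z (parityPart p m) := by
  have h1 := two_mul_aeval_parityPart p m z
  have h2 := two_mul_aeval_parityPart p m (-z)
  have h3 : ((-1 : ℂ) ^ m) * (-1) ^ m = 1 := by rw [← mul_pow]; simp
  rw [neg_neg] at h2
  linear_combination (1 / 2 : ℂ) * h2 - (1 / 2 : ℂ) * (-1) ^ m * h1
    - (1 / 2 : ℂ) * aeval (-z) p * h3

lemma aeval_neg_routhStep (p : ℝ[X]) (m : ℕ) (c : ℝ) (z : ℂ) :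
    (-1) ^ m * aeval (-z) (routhStep p m c)
      = 2 * aeval z (parityPart p m) - aeval z (routhStep p m c) := by
  have h1 := two_mul_aeval_parityPart p m z
  have h3 : ((-1 : ℂ) ^ m) * (-1) ^ m = 1 := by rw [← mul_pow]; simp
  rw [aeval_routhStep, aeval_routhStep, aeval_neg_parityPart]
  linear_combination -h1 + c * z * aeval z (parityPart p m) * h3

lemma norm_neg_one_pow_mul (m : ℕ) (w : ℂ) : ‖(-1) ^ m * w‖ = ‖w‖ := by
  simp

lemma sq_norm_le_re_mul_conj {u v : ℂ} (h : ‖2 * v - u‖ ≤ ‖u‖) :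
    ‖v‖ ^ 2 ≤ (u * starRingEnd ℂ v).re := by
  have h2 := pow_le_pow_left₀ (norm_nonneg _) h 2
  rw [Complex.sq_norm, Complex.sq_norm, Complex.normSq_apply, Complex.normSq_apply] at h2
  rw [Complex.sq_norm, Complex.normSq_apply]
  simp at h2 ⊢
  nlinarith

lemma stable_of_routhStep_stable {p : ℝ[X]} {m : ℕ} {c : ℝ} (hc : 0 ≤ c)
    (h : ∀ z : ℂ, aeval z (routhStep p m c) = 0 → z.re < 0) :
    ∀ z : ℂ, aeval z p = 0 → z.re < 0 := by
  intro z hz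
  by_contra! hre
  have h1 := norm_aeval_neg_le h hre
  rw [← norm_neg_one_pow_mul m, aeval_neg_routhStep] at h1
  have h2 := sq_norm_le_re_mul_conj h1
  have h4 := aeval_routhStep p m c z
  set B := aeval z (parityPart p m)
  have h3 : (aeval z (routhStep p m c) * starRingEnd ℂ B).re = - (c * z.re * ‖B‖ ^ 2) := by
    rw [h4, hz, zero_sub, neg_mul, mul_assoc, Complex.mul_conj, Complex.neg_re, mul_assoc,
      Complex.re_ofReal_mul, Complex.re_mul_ofReal, Complex.sq_norm, mul_assoc]
  rw [h3] at h2
  have hB : B = 0 := by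
    have : 0 ≤ c * z.re * ‖B‖ ^ 2 := by positivity
    have h0 : ‖B‖ ^ 2 = 0 := le_antisymm (by linarith) (by positivity)
    simpa using h0
  rw [hz, hB] at h4
  exact absurd (h z (by simpa using h4)) (not_lt.mpr hre)

lemma one_le_re_div {u v : ℂ} (hv : v ≠ 0) (h : ‖v‖ ^ 2 ≤ (u * starRingEnd ℂ v).re) :
    1 ≤ (u / v).re := by
  have hn : 0 < Complex.normSq v := Complex.normSq_pos.mpr hv
  have : u / v = (u * starRingEnd ℂ v) * ((Complex.normSq v)⁻¹ : ℝ) := by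
    rw [div_eq_mul_inv, Complex.inv_def]; push_cast; ring
  rw [this, Complex.re_mul_ofReal, ← div_eq_mul_inv, le_div_iff₀ hn, one_mul,
    ← Complex.sq_norm]
  exact h

lemma parityPart_ne_zero_and_one_le_re_div {p : ℝ[X]} {m : ℕ} (hdeg : p.natDegree = m + 1)
    (hp : ∀ z : ℂ, aeval z p = 0 → z.re < 0) {z : ℂ} (hz : 0 < z.re) :
    aeval z (parityPart p m) ≠ 0 ∧ 1 ≤ (aeval z p / aeval z (parityPart p m)).re := by
  have h1 := norm_aeval_neg_lt (by omega) hp hz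
  have h2 : 2 * aeval z (parityPart p m) - aeval z p = (-1) ^ m * aeval (-z) p := by
    rw [two_mul_aeval_parityPart]; ring
  rw [← norm_neg_one_pow_mul m, ← h2] at h1
  have hB : aeval z (parityPart p m) ≠ 0 := by
    intro h0
    rw [h0] at h1
    simp at h1
  exact ⟨hB, one_le_re_div hB (sq_norm_le_re_mul_conj h1.le)⟩

lemma isBoundedUnder_norm_exp_neg_div {p q : ℝ[X]} (h : p.degree ≤ q.degree) (ε : ℝ) :
    Filter.IsBoundedUnder (· ≤ ·) Filter.atTop fun x : ℝ =>
      ‖Complex.exp (-(aeval ((x : ℂ) + ε) p / aeval ((x : ℂ) + ε) q))‖ := by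
  have hO := (isBigO_atTop_of_degree_le p q h).comp_tendsto
    (Filter.tendsto_atTop_add_const_right Filter.atTop ε Filter.tendsto_id)
  obtain ⟨K, hK0, hK⟩ := hO.exists_nonneg
  refine ⟨Real.exp K, Filter.eventually_map.mpr ?_⟩
  filter_upwards [hK.bound] with x hx
  have e (r : ℝ[X]) : aeval ((x : ℂ) + ε) r = ((r.eval (x + ε) : ℝ) : ℂ) := by
    have := aeval_algebraMap_apply_eq_algebraMap_eval (A := ℂ) (x + ε) r
    simpa using this
  rw [e, e, Complex.norm_exp, Real.exp_le_exp, ← Complex.ofReal_div, ← Complex.ofReal_neg,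
    Complex.ofReal_re]
  refine (neg_le_abs _).trans ?_
  simp only [Function.comp_apply, id_eq, Real.norm_eq_abs] at hx
  rw [abs_div]
  by_cases h0 : eval (x + ε) q = 0
  · simpa [h0] using hK0
  · rw [div_le_iff₀ (abs_pos.mpr h0)]
    exact hx

lemma one_le_re_routhStep_div_parityPart {p : ℝ[X]} {m : ℕ} {c : ℝ} (hc0 : 0 ≤ c)
    (hdeg : p.natDegree = m + 1) (hm : p.coeff m ≠ 0) (hc : p.coeff (m + 1) = c * p.coeff m)
    (hp : ∀ z : ℂ, aeval z p = 0 → z.re < 0) {z : ℂ} (hz : 0 < z.re) :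
    1 ≤ (aeval z (routhStep p m c) / aeval z (parityPart p m)).re := by
  have hdegB : (routhStep p m c).degree ≤ (parityPart p m).degree := by
    have hB : (parityPart p m).coeff m ≠ 0 := by
      rw [coeff_parityPart, if_pos ⟨m, rfl⟩]; exact hm
    exact (degree_le_of_natDegree_le (natDegree_routhStep_le hdeg.le hc)).trans
      (le_degree_of_ne_zero hB)
  set W : ℂ → ℂ := fun w =>
    Complex.exp (-(aeval w (routhStep p m c) / aeval w (parityPart p m))) with hW
  have hWle : ∀ w : ℂ, 0 < w.re → ‖W w‖ ≤ Real.exp (c * w.re - 1) := by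
    intro w hw
    obtain ⟨hB, h1⟩ := parityPart_ne_zero_and_one_le_re_div hdeg hp hw
    rw [hW, Complex.norm_exp, Real.exp_le_exp, aeval_routhStep, sub_div,
      mul_div_cancel_right₀ _ hB, Complex.neg_re, Complex.sub_re, Complex.re_ofReal_mul]
    linarith
  have hshift : ∀ ε : ℝ, 0 < ε → ∀ w : ℂ, 0 ≤ w.re → ‖W (w + ε)‖ ≤ Real.exp (c * ε - 1) := by
    intro ε hε w hw
    refine PhragmenLindelof.right_half_plane_of_bounded_on_real (f := fun w => W (w + ε))
      ?_ ⟨1, by norm_num, c, ?_⟩ (isBoundedUnder_norm_exp_neg_div hdegB ε) ?_ hw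
    · apply DifferentiableOn.diffContOnCl
      intro y hy
      have hcl : closure {z : ℂ | 0 < z.re} = {z : ℂ | 0 ≤ z.re} := by
        exact Complex.closure_setOfPred_lt_re 0
      rw [hcl] at hy
      have hy' : 0 < (y + (ε : ℂ)).re := by simp at hy ⊢; linarith
      have hne := (parityPart_ne_zero_and_one_le_re_div hdeg hp hy').1
      apply DifferentiableAt.differentiableWithinAt
      have hd : DifferentiableAt ℂ (fun w : ℂ => w + (ε : ℂ)) y := by fun_prop
      refine DifferentiableAt.cexp (DifferentiableAt.neg (DifferentiableAt.div ?_ ?_ hne))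
      · exact ((routhStep p m c).differentiable_aeval (𝕜 := ℂ) _).comp y hd
      · exact ((parityPart p m).differentiable_aeval (𝕜 := ℂ) _).comp y hd
    · refine Asymptotics.IsBigO.of_bound (Real.exp (c * ε - 1)) ?_
      refine Filter.eventually_inf_principal.mpr (Filter.Eventually.of_forall fun y hy => ?_)
      have hy0 : 0 < y.re := hy
      refine (hWle (y + ε) (by simp; linarith)).trans ?_
      rw [Real.norm_eq_abs, Real.abs_exp, ← Real.exp_add, Real.exp_le_exp, Real.rpow_one,
        Complex.add_re, Complex.ofReal_re]
      have := mul_le_mul_of_nonneg_left (Complex.re_le_norm y) hc0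
      linarith
    · intro x
      refine (hWle _ (by simpa using hε)).trans (le_of_eq ?_)
      simp
  have hlim : ∀ ε : ℝ, 0 < ε → ε < z.re → ‖W z‖ ≤ Real.exp (c * ε - 1) := by
    intro ε hε hεz
    have := hshift ε hε (z - ε) (by simp; linarith)
    simpa using this
  have h1 : ‖W z‖ ≤ Real.exp (-1) := by
    have ht : Filter.Tendsto (fun ε : ℝ => Real.exp (c * ε - 1)) (nhdsWithin 0 (Set.Ioi 0))
        (nhds (Real.exp (-1))) := by
      have : Continuous fun ε : ℝ => Real.exp (c * ε - 1) := by fun_prop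
      simpa using (this.tendsto 0).mono_left nhdsWithin_le_nhds
    refine ge_of_tendsto ht ?_
    filter_upwards [Ioo_mem_nhdsGT hz] with ε hε
    exact hlim ε hε.1 hε.2
  rw [hW, Complex.norm_exp, Real.exp_le_exp, Complex.neg_re] at h1
  linarith

lemma routhStep_stable {p : ℝ[X]} {m : ℕ} {c : ℝ} (hc0 : 0 ≤ c)
    (hdeg : p.natDegree = m + 1) (hm : p.coeff m ≠ 0) (hc : p.coeff (m + 1) = c * p.coeff m)
    (hp : ∀ z : ℂ, aeval z p = 0 → z.re < 0) :
    ∀ z : ℂ, aeval z (routhStep p m c) = 0 → z.re < 0 := by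
  intro z hz
  by_contra! hre
  rcases hre.eq_or_lt with h0 | h0
  · have h1 := norm_aeval_neg_of_re_eq_zero (routhStep p m c) h0.symm
    rw [← norm_neg_one_pow_mul m, aeval_neg_routhStep, hz] at h1
    have hB : aeval z (parityPart p m) = 0 := by simpa using h1
    have h2 := aeval_routhStep p m c z
    rw [hz, hB] at h2
    exact absurd (hp z (by simpa using h2.symm)) (not_lt.mpr hre)
  · have h1 := one_le_re_routhStep_div_parityPart hc0 hdeg hm hc hp h0
    rw [hz, zero_div, Complex.zero_re] at h1
    linarith

lemma formalHurwitzDet_one (p : ℝ[X]) (m : ℕ) : formalHurwitzDet p (m + 1) 1 = p.coeff m := by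
  simp [formalHurwitzDet, intCoeff]

/-- The Routh–Hurwitz criterion for roots in the open left half-plane. -/
theorem stable_iff_formalHurwitzDet_pos (m : ℕ) : ∀ p : ℝ[X], p.natDegree = m →
    0 < p.leadingCoeff → ((∀ z : ℂ, aeval z p = 0 → z.re < 0) ↔
      ∀ k : ℕ, 1 ≤ k → k ≤ m → 0 < formalHurwitzDet p m k) := by
  induction m with
  | zero =>
    intro p hdeg hlead
    refine iff_of_true (fun z hz => ?_) (fun k _ _ => by omega)
    rw [eq_C_of_natDegree_eq_zero hdeg] at hz
    rw [leadingCoeff, hdeg] at hlead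
    simp [hlead.ne'] at hz
  | succ m ih =>
    intro p hdeg hlead
    have hlead' : 0 < p.coeff (m + 1) := by rwa [leadingCoeff, hdeg] at hlead
    suffices h : 0 < p.coeff m → ((∀ z : ℂ, aeval z p = 0 → z.re < 0) ↔
        ∀ k : ℕ, 1 ≤ k → k ≤ m + 1 → 0 < formalHurwitzDet p (m + 1) k) by
      refine ⟨fun hp => (h (coeff_pos_of_stable hdeg hlead hp)).mp hp, fun hk => (h ?_).mpr hk⟩
      simpa [formalHurwitzDet_one] using hk 1 le_rfl (by omega)
    intro hm
    set c := p.coeff (m + 1) / p.coeff m with hcdef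
    have hc0 : 0 ≤ c := (div_pos hlead' hm).le
    have hc : p.coeff (m + 1) = c * p.coeff m := (div_mul_cancel₀ _ hm.ne').symm
    have hself := coeff_routhStep_self p m c
    have hdeg' : (routhStep p m c).natDegree = m :=
      natDegree_eq_of_le_of_coeff_ne_zero (natDegree_routhStep_le hdeg.le hc)
        (by rw [hself]; exact hm.ne')
    have hstep := ih (routhStep p m c) hdeg' (by rw [leadingCoeff, hdeg', hself]; exact hm)
    have hdet := formalHurwitzDet_succ hdeg.le hc
    have hiff : (∀ z : ℂ, aeval z p = 0 → z.re < 0) ↔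
        ∀ z : ℂ, aeval z (routhStep p m c) = 0 → z.re < 0 :=
      ⟨routhStep_stable hc0 hdeg hm.ne' hc, stable_of_routhStep_stable hc0⟩
    rw [hiff, hstep]
    constructor
    · rintro h (_ | _ | k) hk1 hk2
      · omega
      · rwa [formalHurwitzDet_one]
      · rw [hdet]
        exact mul_pos hm (h (k + 1) (by omega) (by omega))
    · intro h k hk1 hk2
      have := h (k + 1) (by omega) (by omega)
      rw [hdet] at this
      exact (mul_pos_iff_of_pos_left hm).mp this

lemma intCoeff_X_pow_mul (p : ℝ[X]) (l : ℕ) (k : ℤ) :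
    intCoeff (X ^ l * p) (k + l) = intCoeff p k := by
  unfold intCoeff
  by_cases hk : 0 ≤ k
  · rw [if_pos hk, if_pos (by omega), show (k + l).toNat = k.toNat + l by omega, coeff_X_pow_mul]
  · rw [if_neg hk]
    split_ifs
    · rw [coeff_X_pow_mul', if_neg (by omega)]
    · rfl

lemma intCoeff_reflected (p : ℝ[X]) (m : ℕ) (i j : ℕ) :
    intCoeff (C ((-1) ^ m) * p.comp (-X)) (m - (2 * (j : ℤ) - i + 1))
      = (-1) ^ (i + 1) * intCoeff p (m - (2 * (j : ℤ) - i + 1)) := by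
  unfold intCoeff
  split_ifs with h
  · rw [coeff_C_mul, coeff_comp_neg_X, ← mul_assoc, ← pow_add]
    congr 1
    apply neg_one_pow_congr
    rw [Nat.even_iff, Nat.even_iff]
    omega
  · simp

lemma prod_neg_one_pow_succ (k : ℕ) :
    ∏ i : Fin k, (-1 : ℝ) ^ ((i : ℕ) + 1) = (-1) ^ ((k + 1) / 2) := by
  rw [Fin.prod_univ_eq_prod_range (fun i => (-1 : ℝ) ^ (i + 1))]
  induction k with
  | zero => simp
  | succ k ih =>
    rw [Finset.prod_range_succ, ih, ← pow_add]
    apply neg_one_pow_congr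
    rw [Nat.even_iff, Nat.even_iff]
    rcases Nat.even_or_odd' k with ⟨r, rfl | rfl⟩ <;> omega

lemma formalHurwitzDet_reflected (p : ℝ[X]) (m k : ℕ) :
    formalHurwitzDet (C ((-1) ^ m) * p.comp (-X)) m k
      = (-1) ^ ((k + 1) / 2) * formalHurwitzDet p m k := by
  unfold formalHurwitzDet
  rw [← prod_neg_one_pow_succ, ← Matrix.det_mul_column]
  congr 1
  ext i j
  simp only [Matrix.of_apply]
  exact intCoeff_reflected p m i j

lemma formalHurwitzDet_X_pow_mul (p : ℝ[X]) (l m k : ℕ) :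
    formalHurwitzDet (X ^ l * p) (m + l) k = formalHurwitzDet p m k := by
  unfold formalHurwitzDet
  congr 1
  ext i j
  simp only [Matrix.of_apply]
  rw [← intCoeff_X_pow_mul p l]
  congr 1
  push_cast
  ring

end RouthHurwitz

open RouthHurwitz

/-- **Symmetric extended Routh–Hurwitz criterion.** For a real polynomial of
degree `n` with positive leading coefficient, having `0` as a root of
multiplicity `n₀ < n`, every nonzero complex root has positive real part iff
`(-1)^⌈k/2⌉ Δ_k > 0` for all `k = 1, …, n - n₀`. -/
theorem symmetric_extended_routh_hurwitz_criterion
    (n n₀ : ℕ) (p : Polynomial ℝ)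
    (hdeg : p.degree = n) (hlead : 0 < p.leadingCoeff)
    (hmult : p.rootMultiplicity 0 = n₀) (hn₀ : n₀ < n) :
    (∀ z : ℂ, z ≠ 0 → Polynomial.aeval z p = 0 → 0 < z.re) ↔
      (∀ k : ℕ, 1 ≤ k → k ≤ n - n₀ →
        0 < (-1 : ℝ) ^ ((k + 1) / 2) * hurwitzDet p k) := by
  have hp0 : p ≠ 0 := by rintro rfl; simp at hlead
  obtain ⟨q, hq, hdvd⟩ := Polynomial.exists_eq_pow_rootMultiplicity_mul_and_not_dvd p hp0 0
  rw [hmult, map_zero, sub_zero] at hq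
  rw [map_zero, sub_zero, Polynomial.X_dvd_iff] at hdvd
  have hq0 : q ≠ 0 := by rintro rfl; simp at hdvd
  have hn : p.natDegree = n := Polynomial.natDegree_eq_of_degree_eq_some hdeg
  obtain ⟨m, rfl⟩ : ∃ m, n = m + n₀ := ⟨n - n₀, by omega⟩
  have hqdeg : q.natDegree = m := by
    have h := hn
    rw [hq, Polynomial.natDegree_X_pow_mul n₀ hq0] at h
    omega
  have hqlead : q.leadingCoeff = p.leadingCoeff := by
    rw [hq, Polynomial.leadingCoeff_mul, Polynomial.leadingCoeff_X_pow, one_mul]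
  set f : Polynomial ℝ := Polynomial.C ((-1) ^ m) * q.comp (-Polynomial.X) with hf
  have hfdeg : f.natDegree = m := by
    rw [hf, Polynomial.natDegree_C_mul (by simp), Polynomial.natDegree_comp,
      Polynomial.natDegree_neg, Polynomial.natDegree_X, mul_one, hqdeg]
  have hflead : 0 < f.leadingCoeff := by
    rw [hf, Polynomial.leadingCoeff_mul, Polynomial.leadingCoeff_C,
      Polynomial.comp_neg_X_leadingCoeff_eq, hqdeg, ← mul_assoc, ← mul_pow, hqlead]
    simpa using hlead
  have hroots : (∀ z : ℂ, z ≠ 0 → Polynomial.aeval z p = 0 → 0 < z.re) ↔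
      ∀ z : ℂ, Polynomial.aeval z f = 0 → z.re < 0 := by
    have hfz (z : ℂ) : Polynomial.aeval z f = 0 ↔ Polynomial.aeval (-z) q = 0 := by
      simp [hf, aeval_comp_neg_X]
    have hpz (z : ℂ) (hz : z ≠ 0) : Polynomial.aeval z p = 0 ↔ Polynomial.aeval z q = 0 := by
      simp [hq, hz]
    constructor
    · intro h z hz
      rw [hfz] at hz
      have hz0 : -z ≠ 0 := by
        intro h0
        rw [h0, ← Polynomial.coeff_zero_eq_aeval_zero'] at hz
        exact hdvd (by simpa using hz)
      simpa using h (-z) hz0 ((hpz _ hz0).mpr hz)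
    · intro h z hz0 hz
      have := h (-z) (by rw [hfz, neg_neg]; exact (hpz z hz0).mp hz)
      simpa using this
  rw [hroots, stable_iff_formalHurwitzDet_pos m f hfdeg hflead, Nat.add_sub_cancel]
  have hdet (k : ℕ) : formalHurwitzDet f m k = (-1) ^ ((k + 1) / 2) * hurwitzDet p k := by
    rw [hf, formalHurwitzDet_reflected, hurwitzDet_eq_formalHurwitzDet, hn,
      ← formalHurwitzDet_X_pow_mul q n₀, ← hq]
  simp only [hdet]
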